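/- Let k be an algebraically closed field, let e₁ ≥ … ≥ e_r and d₁ ≥ … ≥ d_r be integers, let U, V ∈ GL_r(k⟦z⟧), and set A := U·diag(z^{e₁}, …, z^{e_r})·V ∈ GL_r(k((z))). Then the following are equivalent: (i) for every 1 ≤ i ≤ r, every i×i minor of A lies in z^{d_{r−i+1}+⋯+d_r}·k⟦z⟧, and det A ∈ z^{d₁+⋯+d_r}·(k⟦z⟧)ˣ; (ii) e₁+⋯+e_i ≤ d₁+⋯+d_i for all 1 ≤ i ≤ r, with equality for i = r. -/

import Mathlib

noncomputable section

open scoped Classical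

namespace HVpaper

variable {A : Type*} [CommRing A]

/-- Coefficientwise `q`-th power map on formal Laurent series (the map `σ` for `q ≠ 0`;
junk value `0` for `q = 0`). -/
def laurentFrob (q : ℕ) (x : LaurentSeries A) : LaurentSeries A :=
  if hq : q = 0 then 0 else x.map (ZeroHom.mk (fun a : A => a ^ q) (zero_pow hq))

/-- Entrywise `σ` on matrices of Laurent series. -/
def matFrob (q : ℕ) {n : Type*} (M : Matrix n n (LaurentSeries A)) :
    Matrix n n (LaurentSeries A) :=
  M.map (laurentFrob q)

/-- `x` lies in `z^n · A⟦z⟧`, i.e. all coefficients below `n` vanish. -/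
def InZPow (n : ℤ) (x : LaurentSeries A) : Prop :=
  ∀ m : ℤ, m < n → x.coeff m = 0

/-- `x` lies in the subring `A⟦z⟧` of `A((z))`. -/
def InPS (x : LaurentSeries A) : Prop :=
  ∀ m : ℤ, m < 0 → x.coeff m = 0

/-- `u` is a unit of the subring `A⟦z⟧` of `A((z))`. -/
def IsPSUnit (u : LaurentSeries A) : Prop :=
  InPS u ∧ ∃ v : LaurentSeries A, InPS v ∧ u * v = 1

/-- The element `z^n` of `A((z))`. -/
def zPow (n : ℤ) : LaurentSeries A :=
  HahnSeries.single n 1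

/-- The coefficientwise map on Laurent series induced by a ring homomorphism. -/
def lmap {B : Type*} [CommRing B] (f : A →+* B) (x : LaurentSeries A) : LaurentSeries B :=
  x.map f

variable {k : Type*} [Field k]

/-- Membership in the subgroup `I_n` of `GL_r(k⟦z⟧)`:  `g` and its inverse have entries in
`k⟦z⟧`, `g ≡ 1 mod z^n` on the diagonal, the entries above the diagonal lie in `z^n k⟦z⟧` and
those below the diagonal lie in `z^(n+1) k⟦z⟧`.  For `n = 0` this is the standard Iwahori
subgroup. -/
def InIwahori {r : ℕ} (n : ℕ) (g : Matrix (Fin r) (Fin r) (LaurentSeries k)) : Prop :=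
  (∀ i j, InPS (g i j)) ∧ IsUnit g ∧ (∀ i j, InPS (g⁻¹ i j)) ∧
  (∀ i : Fin r, InZPow (n : ℤ) (g i i - 1)) ∧
  (∀ i j : Fin r, i < j → InZPow (n : ℤ) (g i j)) ∧
  (∀ i j : Fin r, j < i → InZPow ((n : ℤ) + 1) (g i j))

/-- The sum of the `i` smallest (i.e. last `i`) entries of the nonincreasing tuple `μ`. -/
def lowSum {r : ℕ} (μ : Fin r → ℤ) (i : ℕ) : ℤ :=
  ∑ j : Fin r, if r ≤ (j : ℕ) + i then μ j else 0

/-- The matrix `M` over `A((z))` is bounded by the dominant cocharacter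
`μ = (μ 0 ≥ … ≥ μ (r-1))` of `GL_r`: for each `1 ≤ i ≤ r` every `i×i` minor of `M` lies in
`z^(μ_{r-i+1}+⋯+μ_r)·A⟦z⟧` and `det M = z^(μ_1+⋯+μ_r)` times a unit of `A⟦z⟧`. -/
def BoundedBy {r : ℕ} (μ : Fin r → ℤ) (M : Matrix (Fin r) (Fin r) (LaurentSeries A)) : Prop :=
  (∀ i : Fin r, ∀ ri ci : Fin ((i : ℕ) + 1) → Fin r,
    InZPow (lowSum μ ((i : ℕ) + 1)) ((M.submatrix ri ci).det)) ∧
  (∃ u : LaurentSeries A, IsPSUnit u ∧ M.det = zPow (∑ j, μ j) * u)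


/-- The sum of the first `i` entries of the tuple `e`. -/
def headSum {r : ℕ} (e : Fin r → ℤ) (i : ℕ) : ℤ :=
  ∑ j : Fin r, if (j : ℕ) < i then e j else 0

/-- `g` lies in `GL_r(k⟦z⟧)`:  `g` and its inverse have all entries in `k⟦z⟧`. -/
def InGLPS {r : ℕ} (g : Matrix (Fin r) (Fin r) (LaurentSeries k)) : Prop :=
  (∀ i j, InPS (g i j)) ∧ IsUnit g ∧ (∀ i j, InPS (g⁻¹ i j))

theorem InZPow.mul' {a b : ℤ} {x y : LaurentSeries A} (hx : InZPow a x) (hy : InZPow b y) :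
    InZPow (a + b) (x * y) := by
  intro m hm
  rw [HahnSeries.coeff_mul]
  refine Finset.sum_eq_zero fun ij hij => ?_
  have h := (Finset.mem_antidiagonal.mp hij).2.2
  by_cases h1 : ij.1 < a
  · rw [hx _ h1, zero_mul]
  · rw [hy _ (by omega), mul_zero]

theorem InZPow.zero' (a : ℤ) : InZPow a (0 : LaurentSeries A) := fun _ _ => rfl

theorem InZPow.add' {a : ℤ} {x y : LaurentSeries A} (hx : InZPow a x) (hy : InZPow a y) :
    InZPow a (x + y) := by
  intro m hm
  rw [HahnSeries.coeff_add, hx m hm, hy m hm, add_zero]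

theorem InZPow.neg' {a : ℤ} {x : LaurentSeries A} (hx : InZPow a x) : InZPow a (-x) := by
  intro m hm
  rw [HahnSeries.coeff_neg, hx m hm, neg_zero]

theorem InZPow.sum' {ι : Type*} (s : Finset ι) {a : ℤ} {f : ι → LaurentSeries A}
    (h : ∀ i ∈ s, InZPow a (f i)) : InZPow a (∑ i ∈ s, f i) :=
  Finset.sum_induction f (InZPow a) (fun _ _ => InZPow.add') (InZPow.zero' a) h

theorem InZPow.one' : InZPow 0 (1 : LaurentSeries A) := by
  intro m hm
  rw [HahnSeries.coeff_one, if_neg hm.ne]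

theorem InZPow.prod' {ι : Type*} (s : Finset ι) {a : ι → ℤ} {f : ι → LaurentSeries A}
    (h : ∀ i ∈ s, InZPow (a i) (f i)) : InZPow (∑ i ∈ s, a i) (∏ i ∈ s, f i) := by
  induction s using Finset.induction_on with
  | empty => simpa using InZPow.one'
  | insert i s hi ih =>
    rw [Finset.sum_insert hi, Finset.prod_insert hi]
    exact (h i (Finset.mem_insert_self _ _)).mul'
      (ih fun j hj => h j (Finset.mem_insert_of_mem hj))

theorem InZPow.mono' {a b : ℤ} (hab : a ≤ b) {x : LaurentSeries A} (hx : InZPow b x) :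
    InZPow a x := fun m hm => hx m (by omega)

theorem inZPow_zPow (n : ℤ) : InZPow n (zPow n : LaurentSeries A) := by
  intro m hm
  exact HahnSeries.coeff_single_of_ne hm.ne

theorem le_of_inZPow_zPow {k : Type*} [Field k] {n m : ℤ}
    (h : InZPow n (zPow m : LaurentSeries k)) : n ≤ m := by
  by_contra hlt
  have := h m (by omega)
  simp [zPow] at this

theorem zPow_sum {ι : Type*} (s : Finset ι) (a : ι → ℤ) :
    ∏ i ∈ s, (zPow (a i) : LaurentSeries A) = zPow (∑ i ∈ s, a i) := by
  induction s using Finset.induction_on with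
  | empty => simp [zPow]
  | insert i s hi ih =>
    rw [Finset.sum_insert hi, Finset.prod_insert hi, ih]
    simp [zPow]

/-- All `m × m` minors lie in `z^n A⟦z⟧`. -/
def MB {r : ℕ} (n : ℤ) (m : ℕ) (M : Matrix (Fin r) (Fin r) (LaurentSeries A)) : Prop :=
  ∀ ri ci : Fin m → Fin r, InZPow n ((M.submatrix ri ci).det)

theorem MB.transpose {r : ℕ} {n : ℤ} {m : ℕ} {M : Matrix (Fin r) (Fin r) (LaurentSeries A)}
    (h : MB n m M) : MB n m M.transpose := by
  intro ri ci
  rw [← Matrix.transpose_submatrix, Matrix.det_transpose]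
  exact h ci ri

theorem MB.mul_left {r : ℕ} {n : ℤ} {m : ℕ} {M U : Matrix (Fin r) (Fin r) (LaurentSeries A)}
    (h : MB n m M) (hU : ∀ i j, InPS (U i j)) : MB n m (U * M) := by
  intro ri ci
  have key : ((U * M).submatrix ri ci).det =
      ∑ f : Fin m → Fin r, (∏ i, U (ri i) (f i)) * (M.submatrix f ci).det := by
    have h1 : (U * M).submatrix ri ci =
        fun i => ∑ j : Fin r, U (ri i) j • (fun c => M j (ci c)) := by
      ext i c
      simp [Matrix.mul_apply, Finset.sum_apply]
    rw [h1]
    have h2 := (Matrix.detRowAlternating (n := Fin m)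
      (R := LaurentSeries A)).toMultilinearMap.map_sum
        (fun i (j : Fin r) => U (ri i) j • (fun c => M j (ci c)))
    refine h2.trans (Finset.sum_congr rfl fun f _ => ?_)
    exact (Matrix.detRowAlternating (n := Fin m)
      (R := LaurentSeries A)).toMultilinearMap.map_smul_univ
        (fun i => U (ri i) (f i)) (fun i c => M (f i) (ci c))
  rw [key]
  refine InZPow.sum' _ fun f _ => ?_
  have := (InZPow.prod' Finset.univ (a := fun _ => 0)
    (f := fun i => U (ri i) (f i)) (fun i _ => hU _ _)).mul' (h f ci)
  simpa using this

theorem MB.mul_right {r : ℕ} {n : ℤ} {m : ℕ} {M U : Matrix (Fin r) (Fin r) (LaurentSeries A)}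
    (h : MB n m M) (hU : ∀ i j, InPS (U i j)) : MB n m (M * U) := by
  have := (h.transpose.mul_left (U := U.transpose) (fun i j => hU j i)).transpose
  rwa [← Matrix.transpose_mul, Matrix.transpose_transpose] at this

theorem MB_conj_iff {k : Type*} [Field k] {r : ℕ} {n : ℤ} {m : ℕ}
    {D U V : Matrix (Fin r) (Fin r) (LaurentSeries k)} (hU : InGLPS U) (hV : InGLPS V) :
    MB n m (U * D * V) ↔ MB n m D := by
  constructor
  · intro h
    have h1 := (h.mul_left hU.2.2).mul_right hV.2.2
    have hu : U⁻¹ * U = 1 := Matrix.nonsing_inv_mul _ ((Matrix.isUnit_iff_isUnit_det _).1 hU.2.1)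
    have hv : V * V⁻¹ = 1 := Matrix.mul_nonsing_inv _ ((Matrix.isUnit_iff_isUnit_det _).1 hV.2.1)
    have : U⁻¹ * (U * D * V) * V⁻¹ = D := by
      calc U⁻¹ * (U * D * V) * V⁻¹ = (U⁻¹ * U) * D * (V * V⁻¹) := by
            simp only [Matrix.mul_assoc]
        _ = D := by rw [hu, hv, Matrix.one_mul, Matrix.mul_one]
    rwa [this] at h1
  · intro h
    exact (h.mul_left hU.1).mul_right hV.1

/-- The embedding onto the last `m` indices. -/
def lastEmb {r m : ℕ} (hm : m ≤ r) (i : Fin m) : Fin r := ⟨r - m + i, by omega⟩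

theorem lastEmb_inj {r m : ℕ} (hm : m ≤ r) : Function.Injective (lastEmb hm) := by
  intro i j h
  simp only [lastEmb, Fin.mk.injEq] at h
  exact Fin.ext (by omega)

theorem lastEmb_image {r m : ℕ} (hm : m ≤ r) :
    Finset.univ.image (lastEmb hm) = Finset.univ.filter (fun j : Fin r => r ≤ (j : ℕ) + m) := by
  ext j
  simp only [Finset.mem_image, Finset.mem_univ, true_and, Finset.mem_filter]
  constructor
  · rintro ⟨i, rfl⟩
    simp only [lastEmb]
    omega
  · intro h
    refine ⟨⟨j - (r - m), by omega⟩, ?_⟩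
    ext
    simp only [lastEmb]
    omega

theorem lowSum_eq {r m : ℕ} (hm : m ≤ r) (e : Fin r → ℤ) :
    lowSum e m = ∑ i : Fin m, e (lastEmb hm i) := by
  rw [lowSum, ← Finset.sum_filter, ← lastEmb_image hm,
    Finset.sum_image fun i _ j _ h => lastEmb_inj hm h]

theorem lowSum_le {r m : ℕ} (hm : m + 1 ≤ r) (e : Fin r → ℤ) (he : Antitone e)
    (f : Fin (m + 1) → Fin r) (hf : Function.Injective f) :
    lowSum e (m + 1) ≤ ∑ i, e (f i) := by
  set c := e ⟨r - (m + 1), by omega⟩ with hc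
  have key : lowSum (fun j => e j - c) (m + 1) ≤ ∑ i, (e (f i) - c) := by
    have h1 : ∑ i, (e (f i) - c) =
        ∑ j : Fin r, if j ∈ Finset.univ.image f then e j - c else 0 := by
      rw [← Finset.sum_filter, Finset.filter_mem_eq_inter, Finset.univ_inter,
        Finset.sum_image fun i _ j _ h => hf h]
    rw [h1, lowSum]
    refine Finset.sum_le_sum fun j _ => ?_
    by_cases hj : r ≤ (j : ℕ) + (m + 1)
    · have : e j ≤ c := he (by rw [Fin.le_def]; simp only; omega)
      rw [if_pos hj]
      split_ifs <;> omega
    · have : c ≤ e j := he (by rw [Fin.le_def]; simp only; omega)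
      rw [if_neg hj]
      split_ifs <;> omega
  rw [lowSum_eq hm] at key ⊢
  simp only [Finset.sum_sub_distrib] at key
  linarith

theorem MB_diag_iff {k : Type*} [Field k] {r : ℕ} {n : ℤ} {m : ℕ} (hm : m + 1 ≤ r)
    (e : Fin r → ℤ) (he : Antitone e) :
    MB n (m + 1) (Matrix.diagonal (fun i => (zPow (e i) : LaurentSeries k))) ↔
      n ≤ lowSum e (m + 1) := by
  constructor
  · intro h
    have h1 := h (lastEmb hm) (lastEmb hm)
    rw [Matrix.submatrix_diagonal _ _ (lastEmb_inj hm), Matrix.det_diagonal] at h1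
    simp only [Function.comp_def] at h1
    rw [zPow_sum, ← lowSum_eq hm] at h1
    exact le_of_inZPow_zPow h1
  · intro h ri ci
    by_cases hci : Function.Injective ci
    · refine InZPow.mono' (h.trans (lowSum_le hm e he ci hci)) ?_
      rw [Matrix.det_apply]
      refine InZPow.sum' _ fun σ _ => ?_
      have hp : InZPow (∑ i, e (ci i)) (∏ i, (Matrix.diagonal
          (fun i => (zPow (e i) : LaurentSeries k))).submatrix ri ci (σ i) i) := by
        refine InZPow.prod' _ fun i _ => ?_
        rw [Matrix.submatrix_apply, Matrix.diagonal_apply]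
        split_ifs with hh
        · rw [hh]; exact inZPow_zPow _
        · exact InZPow.zero' _
      rcases Int.units_eq_one_or (Equiv.Perm.sign σ) with hs | hs
      · rw [hs, one_smul]; exact hp
      · rw [hs, Units.neg_smul, one_smul]; exact hp.neg'
    · simp only [Function.Injective, not_forall] at hci
      obtain ⟨i, j, hij, hne⟩ := hci
      rw [Matrix.det_zero_of_column_eq hne (fun l => by simp [hij])]
      exact InZPow.zero' _

theorem head_add_low {r i : ℕ} (hi : i ≤ r) (e : Fin r → ℤ) :
    headSum e i + lowSum e (r - i) = ∑ j, e j := by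
  rw [headSum, lowSum, ← Finset.sum_add_distrib]
  refine Finset.sum_congr rfl fun j _ => ?_
  split_ifs <;> omega

theorem InPS.det {r : ℕ} {U : Matrix (Fin r) (Fin r) (LaurentSeries A)}
    (hU : ∀ i j, InPS (U i j)) : InPS U.det := by
  have h0 : MB 0 r (1 : Matrix (Fin r) (Fin r) (LaurentSeries A)) := by
    intro ri ci
    rw [Matrix.det_apply]
    refine InZPow.sum' _ fun σ _ => ?_
    have hp : InZPow 0 (∏ i, (1 : Matrix (Fin r) (Fin r) (LaurentSeries A)).submatrix
        ri ci (σ i) i) := by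
      have := InZPow.prod' Finset.univ (a := fun _ => 0) (f := fun i =>
        (1 : Matrix (Fin r) (Fin r) (LaurentSeries A)).submatrix ri ci (σ i) i) (fun i _ => by
          rw [Matrix.submatrix_apply, Matrix.one_apply]
          split_ifs
          · exact InZPow.one'
          · exact InZPow.zero' _)
      simpa using this
    rcases Int.units_eq_one_or (Equiv.Perm.sign σ) with hs | hs
    · rw [hs, one_smul]; exact hp
    · rw [hs, Units.neg_smul, one_smul]; exact hp.neg'
  have := (h0.mul_left hU) id id
  have h3 : InZPow 0 U.det := by simpa using this
  exact h3

theorem InGLPS.det {k : Type*} [Field k] {r : ℕ} {U : Matrix (Fin r) (Fin r) (LaurentSeries k)}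
    (hU : InGLPS U) : IsPSUnit U.det := by
  refine ⟨InPS.det hU.1, U⁻¹.det, InPS.det hU.2.2, ?_⟩
  rw [← Matrix.det_mul,
    Matrix.mul_nonsing_inv _ ((Matrix.isUnit_iff_isUnit_det _).1 hU.2.1), Matrix.det_one]

theorem IsPSUnit.mul {u v : LaurentSeries A} (hu : IsPSUnit u) (hv : IsPSUnit v) :
    IsPSUnit (u * v) := by
  obtain ⟨hu, u', hu', h1⟩ := hu
  obtain ⟨hv, v', hv', h2⟩ := hv
  refine ⟨?_, u' * v', ?_, ?_⟩
  · simpa [InPS, InZPow] using InZPow.mul' (a := 0) (b := 0) hu hv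
  · simpa [InPS, InZPow] using InZPow.mul' (a := 0) (b := 0) hu' hv'
  · rw [mul_mul_mul_comm, h1, h2, one_mul]

theorem le_of_zPow_mul {k : Type*} [Field k] {a b : ℤ} {u v : LaurentSeries k}
    (hu : InPS u) (hv : IsPSUnit v) (h : zPow a * u = zPow b * v) : a ≤ b := by
  obtain ⟨-, v', hv', h2⟩ := hv
  have h3 : zPow b = zPow a * u * v' := by rw [h, mul_assoc, h2, mul_one]
  apply le_of_inZPow_zPow (k := k)
  rw [h3]
  simpa using ((inZPow_zPow a).mul' (b := 0) hu).mul' (b := 0) hv'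

/-- **Lemma 3.9 combined with Lemma 4.3** for `G = GL_r`:  a matrix with elementary divisors
`z^(e 0), …, z^(e (r-1))` is bounded by `μ = (d 0 ≥ … ≥ d (r-1))` (in the sense of the minor
conditions) if and only if `(e_i) ⪯ (d_i)` in the dominance order. -/
theorem bounded_iff_hodge_le
    {k : Type*} [Field k] [IsAlgClosed k] {r : ℕ}
    (e d : Fin r → ℤ) (he : Antitone e) (hd : Antitone d)
    (U V : Matrix (Fin r) (Fin r) (LaurentSeries k))
    (hU : InGLPS U) (hV : InGLPS V) :
    BoundedBy d (U * Matrix.diagonal (fun i => zPow (e i)) * V) ↔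
      ((∀ i : ℕ, i ≤ r → headSum e i ≤ headSum d i) ∧
        (∑ j, e j) = ∑ j, d j) := by
  have hdet : (U * Matrix.diagonal (fun i => zPow (e i)) * V).det =
      zPow (∑ j, e j) * (U.det * V.det) := by
    rw [Matrix.det_mul, Matrix.det_mul, Matrix.det_diagonal, zPow_sum]
    ring
  have hu : IsPSUnit (U.det * V.det) := hU.det.mul hV.det
  have hdet' : (∃ u : LaurentSeries k, IsPSUnit u ∧
      (U * Matrix.diagonal (fun i => zPow (e i)) * V).det = zPow (∑ j, d j) * u) ↔
      ∑ j, e j = ∑ j, d j := by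
    rw [hdet]
    constructor
    · rintro ⟨u, hu', h⟩
      exact le_antisymm (le_of_zPow_mul hu.1 hu' h) (le_of_zPow_mul hu'.1 hu h.symm)
    · intro h
      exact ⟨_, hu, by rw [h]⟩
  have hmin : (∀ i : Fin r, ∀ ri ci : Fin ((i : ℕ) + 1) → Fin r,
      InZPow (lowSum d ((i : ℕ) + 1))
        (((U * Matrix.diagonal (fun i => zPow (e i)) * V).submatrix ri ci).det)) ↔
      ∀ i : Fin r, lowSum d ((i : ℕ) + 1) ≤ lowSum e ((i : ℕ) + 1) :=
    forall_congr' fun i => (MB_conj_iff hU hV).trans (MB_diag_iff i.2 e he)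
  rw [BoundedBy, hdet', hmin]
  refine and_congr_left fun htot => ⟨fun h i hi => ?_, fun h i => ?_⟩
  · have h1 := head_add_low hi e
    have h2 := head_add_low hi d
    rcases hi.lt_or_eq with hlt | rfl
    · have h3 := h ⟨r - i - 1, by omega⟩
      simp only [show r - i - 1 + 1 = r - i by omega] at h3
      linarith
    · have h0 : ∀ f : Fin i → ℤ, lowSum f (i - i) = 0 := fun f =>
        Finset.sum_eq_zero fun j _ => if_neg (by omega)
      rw [h0] at h1 h2
      linarith
  · have hi : r - (i + 1) ≤ r := by omega
    have h1 := head_add_low hi e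
    have h2 := head_add_low hi d
    have h3 := h _ hi
    rw [show r - (r - ((i : ℕ) + 1)) = i + 1 by omega] at h1 h2
    linarith

end HVpaper
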